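/- arXiv:math/0411091 — 7 statements merged into one kernel-verified Lean document; each statement's English description precedes it below -/
import Mathlib

section
/- Kraft's inequality for prefix-free codes: if S is a prefix-free set of finite binary strings, then the series ∑_{s ∈ S} 2^{-|s|} is summable and its sum is at most 1. -/
/-- A set of finite binary strings is prefix-free if no element is a proper
prefix of another element. -/
def PrefixFree (S : Set (List Bool)) : Prop :=
  ∀ s ∈ S, ∀ t ∈ S, s <+: t → s = t

theorem PrefixFree.mono {S T : Set (List Bool)} (hT : PrefixFree T) (h : S ⊆ T) :
    PrefixFree S :=
  fun s hs t ht => hT s (h hs) t (h ht)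

theorem PrefixFree.uniquelyDecodable {S : Set (List Bool)} (hS : PrefixFree S)
    (hnil : [] ∉ S) : InformationTheory.UniquelyDecodable S := by
  intro L₁
  induction L₁ with
  | nil =>
    rintro (_ | ⟨b, L₂⟩) - h₂ h
    · rfl
    · simp only [List.flatten_nil, List.flatten_cons, List.nil_eq, List.append_eq_nil_iff] at h
      exact absurd (h.1 ▸ h₂ b (by simp)) hnil
  | cons a L₁ ih =>
    rintro (_ | ⟨b, L₂⟩) h₁ h₂ h
    · simp only [List.flatten_nil, List.flatten_cons, List.append_eq_nil_iff] at h
      exact absurd (h.1 ▸ h₁ a (by simp)) hnil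
    · have ha : a ∈ S := h₁ a (by simp)
      have hb : b ∈ S := h₂ b (by simp)
      rw [List.flatten_cons, List.flatten_cons] at h
      have hab : a = b := by
        rcases List.prefix_or_prefix_of_prefix (List.prefix_append a L₁.flatten)
          (h ▸ List.prefix_append b L₂.flatten) with hp | hp
        · exact hS a ha b hb hp
        · exact (hS b hb a ha hp).symm
      subst hab
      rw [ih L₂ (fun w hw => h₁ w (by simp [hw])) (fun w hw => h₂ w (by simp [hw]))
        (List.append_cancel_left h)]

theorem PrefixFree.sum_two_zpow_neg_length_le_one {F : Finset (List Bool)}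
    (hF : PrefixFree (F : Set (List Bool))) :
    ∑ s ∈ F, (2 : ℝ) ^ (-(s.length : ℤ)) ≤ 1 := by
  by_cases hnil : [] ∈ F
  · have : F = {[]} := Finset.eq_singleton_iff_unique_mem.2
      ⟨hnil, fun s hs => (hF [] hnil s hs List.nil_prefix).symm⟩
    simp [this]
  · simpa using InformationTheory.kraft_mcmillan_inequality
      (hF.uniquelyDecodable (by simpa using hnil))

theorem kraft_inequality (S : Set (List Bool)) (hS : PrefixFree S) :
    Summable (fun s : S => (2 : ℝ) ^ (-(s.1.length : ℤ))) ∧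
      ∑' s : S, (2 : ℝ) ^ (-(s.1.length : ℤ)) ≤ 1 := by
  have hsum (F : Finset S) : ∑ s ∈ F, (2 : ℝ) ^ (-(s.1.length : ℤ)) ≤ 1 := by
    have hF : PrefixFree (F.map (Function.Embedding.subtype (· ∈ S)) : Set (List Bool)) :=
      hS.mono fun s hs => by
        obtain ⟨t, -, rfl⟩ := Finset.mem_map.1 (Finset.mem_coe.1 hs)
        exact t.2
    simpa only [Finset.sum_map, Function.Embedding.subtype_apply] using hF.sum_two_zpow_neg_length_le_one
  have hsummable := summable_of_sum_le (fun s : S => by positivity) hsum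
  exact ⟨hsummable, hsummable.tsum_le_of_sum_le hsum⟩
end

section
/- Knowing the halting probability to N bits of accuracy identifies all halting programs of size at most N: let S be a prefix-free set of finite binary strings whose weight series is summable with sum Ω, and let F be a finite subset of S such that ∑_{s ∈ F} 2^{-|s|} > Ω - 2^{-N}. Then every s ∈ S with |s| ≤ N belongs to F. -/
theorem omega_bits_solve_halting (S : Set (List Bool)) (hS : PrefixFree S)
    (Ω : ℝ) (hΩ : HasSum (fun s : S => (2 : ℝ) ^ (-(s.1.length : ℤ))) Ω)
    (N : ℕ) (F : Finset (List Bool)) (hF : ↑F ⊆ S)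
    (hsum : Ω - (2 : ℝ) ^ (-(N : ℤ)) < ∑ s ∈ F, (2 : ℝ) ^ (-(s.length : ℤ))) :
    ∀ s ∈ S, s.length ≤ N → s ∈ F := by
  intro s hs hlen
  by_contra hsF
  have hsub : ∀ t ∈ insert s F, t ∈ S := by
    simpa [hs] using fun t ht => hF ht
  have hle := sum_le_hasSum (insert s F)
    (fun t _ => Set.indicator_nonneg (fun _ _ => by positivity) t)
    ((hasSum_subtype_iff_indicator
      (f := fun t : List Bool => (2 : ℝ) ^ (-(t.length : ℤ)))).1 hΩ)
  rw [Finset.sum_congr rfl fun t ht => Set.indicator_of_mem (hsub t ht) _,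
    Finset.sum_insert hsF] at hle
  have hpow : (2 : ℝ) ^ (-(N : ℤ)) ≤ (2 : ℝ) ^ (-(s.length : ℤ)) :=
    zpow_le_zpow_right₀ one_le_two (by omega)
  linarith
end

section
/- The complexity function K : ℕ → ℕ is not computable. -/
/-- The complexity of `n` : the least code (as a natural number) that outputs
`n` on input `0`. -/
noncomputable def K (n : ℕ) : ℕ :=
  sInf {e | (Denumerable.ofNat Nat.Partrec.Code e).eval 0 = Part.some n}

theorem eval_K (n : ℕ) :
    (Denumerable.ofNat Nat.Partrec.Code (K n)).eval 0 = Part.some n :=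
  Nat.sInf_mem (s := {e | (Denumerable.ofNat Nat.Partrec.Code e).eval 0 = Part.some n})
    ⟨Encodable.encode (Nat.Partrec.Code.const n), by simp⟩

theorem K_le_encode {c : Nat.Partrec.Code} {n : ℕ} (h : c.eval 0 = Part.some n) :
    K n ≤ Encodable.encode c :=
  Nat.sInf_le (by simpa using h)

theorem K_injective : Function.Injective K := fun m n h =>
  Part.some_injective ((eval_K m).symm.trans (h ▸ eval_K n))

theorem exists_lt_K (e : ℕ) : ∃ n, e < K n := by
  obtain ⟨_, ⟨n, rfl⟩, h⟩ := (Set.infinite_range_of_injective K_injective).exists_gt e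
  exact ⟨n, h⟩

theorem K_not_computable : ¬ Computable K := by
  intro hK
  have hlt : Computable₂ fun (p : Nat.Partrec.Code × ℕ) (n : ℕ) =>
      decide (Encodable.encode p.1 < K n) :=
    (Primrec.nat_lt.decide.to_comp).comp
      (Computable.encode.comp (Computable.fst.comp Computable.fst)) (hK.comp Computable.snd)
  have hf : Partrec₂ fun (c : Nat.Partrec.Code) (_ : ℕ) =>
      Nat.rfind fun n => Part.some (decide (Encodable.encode c < K n)) :=
    Partrec.rfind hlt.partrec₂
  obtain ⟨c, hc⟩ := Nat.Partrec.Code.fixed_point₂ hf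
  obtain ⟨m, hm⟩ := exists_lt_K (Encodable.encode c)
  obtain ⟨n, hn, -⟩ := Nat.rfind_min' (p := fun n => decide (Encodable.encode c < K n))
    (m := m) (by simpa using hm)
  have hlarge : Encodable.encode c < K n := by simpa using Nat.rfind_spec hn
  exact hlarge.not_ge (K_le_encode ((congrFun hc 0).trans (Part.eq_some_iff.2 hn)))
end

section
/- The halting probability real number α is irrational. -/
open Classical in
/-- The halting probability: `∑ 2^{-(e+1)}` over all codes `e` that halt on
input `0`. -/
noncomputable def haltingProbability : ℝ :=
  ∑' e : ℕ,
    if ((Denumerable.ofNat Nat.Partrec.Code e).eval 0).Dom then (2 : ℝ) ^ (-(e + 1 : ℤ)) else 0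

/-- The real number in `[0, 1]` whose binary digits after the point are given by `f`. -/
noncomputable def binaryReal (f : ℕ → Bool) : ℝ :=
  ∑' n, if f n then (1 / 2 : ℝ) ^ (n + 1) else 0

theorem hasSum_half_pow_succ : HasSum (fun n : ℕ => (1 / 2 : ℝ) ^ (n + 1)) 1 := by
  have h := hasSum_geometric_two.mul_left (1 / 2 : ℝ)
  norm_num at h
  simpa [pow_succ'] using h

theorem summable_binaryReal (f : ℕ → Bool) :
    Summable fun n => if f n then (1 / 2 : ℝ) ^ (n + 1) else 0 := by
  refine Summable.of_nonneg_of_le (fun n => ?_) (fun n => ?_) hasSum_half_pow_succ.summable <;>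
  split_ifs <;> first | positivity | exact le_rfl

theorem binaryReal_pos {f : ℕ → Bool} {n : ℕ} (h : f n = true) : 0 < binaryReal f := by
  refine (summable_binaryReal f).tsum_pos (fun k => ?_) n ?_
  · split_ifs <;> positivity
  · simp [h]

theorem binaryReal_add_binaryReal_not (f : ℕ → Bool) :
    binaryReal f + binaryReal (fun n => !f n) = 1 := by
  rw [binaryReal, binaryReal,
    ← (summable_binaryReal f).tsum_add (summable_binaryReal fun n => !f n)]
  refine Eq.trans ?_ hasSum_half_pow_succ.tsum_eq
  refine tsum_congr fun n => ?_
  cases f n <;> simp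

theorem binaryReal_lt_one {f : ℕ → Bool} {n : ℕ} (h : f n = false) : binaryReal f < 1 := by
  have h₁ := binaryReal_add_binaryReal_not f
  have h₂ := binaryReal_pos (f := fun n => !f n) (n := n) (by simp [h])
  linarith

theorem two_mul_binaryReal (f : ℕ → Bool) :
    2 * binaryReal f = (if f 0 then 1 else 0) + binaryReal fun n => f (n + 1) := by
  rw [binaryReal, (summable_binaryReal f).tsum_eq_zero_add, mul_add, ← tsum_mul_left, binaryReal]
  congr 1
  · split_ifs <;> norm_num
  · congr 1 with n
    split_ifs <;> ring

theorem computable_of_eventually_const {b : Bool} (N : ℕ) {f : ℕ → Bool}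
    (h : ∀ n, N ≤ n → f n = b) : Computable f := by
  induction N generalizing f with
  | zero =>
    obtain rfl : f = fun _ => b := funext fun n => h n n.zero_le
    exact Computable.const b
  | succ N ih =>
    have hs : Computable fun n => f (n + 1) := ih fun n hn => h (n + 1) (by omega)
    refine (Computable.nat_casesOn Computable.id (Computable.const (f 0))
      (hs.comp Computable.snd).to₂).of_eq fun n => ?_
    cases n <;> rfl

/-- The remainders of the long division of `p` by `q` in base two. -/
def binaryRemainder (p q : ℕ) (n : ℕ) : ℕ :=
  Nat.rec p (fun _ s => 2 * s % q) n

theorem primrec_binaryRemainder (p q : ℕ) : Primrec (binaryRemainder p q) :=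
  Primrec.nat_rec₁ p (Primrec.nat_mod.comp
    (Primrec.nat_mul.comp (Primrec.const 2) Primrec.snd) (Primrec.const q)).to₂

/-- If `f` is not eventually constant, the tails of the expansion of `p / q` are given by the
remainders of long division. -/
theorem mul_binaryReal_tail {f : ℕ → Bool} {p q : ℕ} (hq : 0 < q)
    (hlt : ∀ N, binaryReal (fun n => f (N + n)) < 1) (h : q * binaryReal f = p) (n : ℕ) :
    q * binaryReal (fun k => f (n + k)) = binaryRemainder p q n := by
  have hq' : (0 : ℝ) < q := by exact_mod_cast hq
  induction n with
  | zero => simpa [binaryRemainder] using h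
  | succ n ih =>
    have hrec := two_mul_binaryReal fun k => f (n + k)
    have hshift : (fun k => f (n + (k + 1))) = fun k => f (n + 1 + k) := by
      funext k; congr 1; omega
    simp only [hshift, add_zero] at hrec
    have hnonneg : 0 ≤ binaryReal fun k => f (n + 1 + k) :=
      tsum_nonneg fun k => by split_ifs <;> positivity
    have hone := hlt (n + 1)
    set t := binaryReal fun k => f (n + 1 + k)
    set s := binaryRemainder p q n
    have key : (2 * s : ℝ) = q * (if f n then 1 else 0) + q * t := by
      rw [← ih, ← mul_add, ← hrec]; ring
    have hs : binaryRemainder p q (n + 1) = 2 * s % q := rfl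
    rw [hs]
    have hqt : q * t < q := by nlinarith
    have hqt₀ : 0 ≤ q * t := by positivity
    cases hf : f n
    · simp only [hf, Bool.false_eq_true, if_false, mul_zero, zero_add] at key
      rw [Nat.mod_eq_of_lt (by rw [← key] at hqt; exact_mod_cast hqt), ← key]
      push_cast; rfl
    · simp only [hf, if_true, mul_one] at key
      have hle : q ≤ 2 * s := by
        have : (q : ℝ) ≤ 2 * s := by linarith
        exact_mod_cast this
      have hlt' : 2 * s < q + q := by
        have : (2 * s : ℝ) < q + q := by linarith
        exact_mod_cast this
      rw [Nat.mod_eq_sub_mod hle, Nat.mod_eq_of_lt (by omega), Nat.cast_sub hle]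
      push_cast; linarith

/-- The binary digits of a rational number are computable. -/
theorem computable_of_not_irrational {f : ℕ → Bool} (h : ¬ Irrational (binaryReal f)) :
    Computable f := by
  by_cases hc : ∃ b N, ∀ n, N ≤ n → f n = b
  · obtain ⟨b, N, hN⟩ := hc
    exact computable_of_eventually_const N hN
  push Not at hc
  have hlt (N : ℕ) : binaryReal (fun n => f (N + n)) < 1 := by
    obtain ⟨n, hn, hf⟩ := hc true N
    exact binaryReal_lt_one (n := n - N) (by simpa [Nat.add_sub_cancel' hn] using hf)
  have hpos (N : ℕ) : 0 < binaryReal (fun n => f (N + n)) := by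
    obtain ⟨n, hn, hf⟩ := hc false N
    exact binaryReal_pos (n := n - N) (by simpa [Nat.add_sub_cancel' hn] using hf)
  obtain ⟨r, hr⟩ := not_not.mp h
  have hr₀ : 0 < r := by
    have := hpos 0
    simp only [zero_add] at this
    rw [← hr] at this
    exact_mod_cast this
  have hq : (0 : ℝ) < r.den := by exact_mod_cast r.den_pos
  have hnum : (r.num.toNat : ℤ) = r.num := Int.toNat_of_nonneg (Rat.num_nonneg.mpr hr₀.le)
  have hp : r.den * binaryReal f = r.num.toNat := by
    rw [← hr, mul_comm]
    exact_mod_cast (Rat.mul_den_eq_num r).trans (congrArg (Int.cast : ℤ → ℚ) hnum.symm)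
  have htail := mul_binaryReal_tail r.den_pos hlt hp
  have hprim : PrimrecPred fun n => r.den ≤ 2 * binaryRemainder r.num.toNat r.den n :=
    Primrec.nat_le.comp (Primrec.const _)
      (Primrec.nat_mul.comp (Primrec.const 2) (primrec_binaryRemainder _ _))
  refine hprim.decide.to_comp.of_eq fun n => ?_
  have hrec := two_mul_binaryReal fun k => f (n + k)
  have hshift : (fun k => f (n + (k + 1))) = fun k => f (n + 1 + k) := by
    funext k; congr 1; omega
  simp only [hshift, add_zero] at hrec
  have h₀ := hpos (n + 1)
  have h₁ := hlt (n + 1)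
  have hcast : (r.den : ℝ) ≤ 2 * binaryRemainder r.num.toNat r.den n ↔
      r.den ≤ 2 * binaryRemainder r.num.toNat r.den n := by exact_mod_cast Iff.rfl
  have ht := htail n
  cases hf : f n <;> simp only [hf, Bool.false_eq_true, if_false, if_true] at hrec
  · rw [decide_eq_false_iff_not, ← hcast, ← ht]
    nlinarith
  · rw [decide_eq_true_iff, ← hcast, ← ht]
    nlinarith

theorem haltingProbability_irrational : Irrational haltingProbability := by
  classical
  let f : ℕ → Bool := fun e => decide ((Denumerable.ofNat Nat.Partrec.Code e).eval 0).Dom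
  have hf : haltingProbability = binaryReal f := by
    unfold haltingProbability binaryReal
    congr 1 with e
    have hpow : (2 : ℝ) ^ (-(e + 1 : ℤ)) = (1 / 2) ^ (e + 1) := by
      rw [zpow_neg, one_div, inv_pow]
      norm_cast
    simp only [f, decide_eq_true_eq, hpow]
  by_contra h
  rw [hf] at h
  refine ComputablePred.halting_problem 0 (ComputablePred.computable_iff.mpr
    ⟨fun c => f (Encodable.encode c),
      (computable_of_not_irrational h).comp Computable.encode, ?_⟩)
  funext c
  simp [f]
end

section
/- The binary digits of the halting probability α solve the halting problem: for every natural number e, code e halts on input 0 if and only if ⌊2^{e+1} · α⌋ is odd. -/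
theorem Nat.Partrec.Code.infinite_setOf_not_dom_eval (n : ℕ) :
    {e : ℕ | ¬ ((Denumerable.ofNat Nat.Partrec.Code e).eval n).Dom}.Infinite := by
  obtain ⟨c, hc⟩ := Nat.Partrec.Code.exists_code.1 Nat.Partrec.none
  refine Set.infinite_of_injective_forall_mem
    (f := fun k => Encodable.encode (Nat.Partrec.Code.curry c k)) ?_ ?_
  · intro a b hab
    exact (Nat.Partrec.Code.curry_inj (Encodable.encode_injective hab)).2
  · intro k
    rw [Set.mem_ofPred_eq, Denumerable.ofNat_encode, Nat.Partrec.Code.eval_curry, hc]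
    exact id

section BinaryExpansion

variable {p : ℕ → Prop} [DecidablePred p]

theorem summable_ite_two_zpow :
    Summable fun n : ℕ => if p n then (2 : ℝ) ^ (-(n + 1 : ℤ)) else 0 := by
  refine Summable.of_nonneg_of_le (fun n => ?_) (fun n => ?_) (summable_geometric_two' 1)
  · split_ifs <;> positivity
  · have h : (2 : ℝ) ^ (-(n + 1 : ℤ)) = 1 / 2 / 2 ^ n := by
      rw [zpow_neg, zpow_add₀ two_ne_zero, zpow_natCast, zpow_one]
      field_simp
    split_ifs
    · exact h.le
    · positivity

theorem exists_int_eq_two_pow_mul_sum_ite (n : ℕ) :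
    ∃ N : ℤ, (2 : ℝ) ^ n *
      ∑ i ∈ Finset.range n, (if p i then (2 : ℝ) ^ (-(i + 1 : ℤ)) else 0) = N := by
  refine ⟨∑ i ∈ Finset.range n, if p i then (2 : ℤ) ^ (n - (i + 1)) else 0, ?_⟩
  push_cast
  rw [Finset.mul_sum]
  refine Finset.sum_congr rfl fun i hi => ?_
  have hin : i + 1 ≤ n := Finset.mem_range.1 hi
  split_ifs
  · rw [pow_sub₀ _ two_ne_zero hin, zpow_neg]
    norm_cast
  · simp

/-- If the digits given by `p` are not eventually all `1`, then they can be read off from the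
binary fraction `∑ 2^{-(n+1)}` over all `n` satisfying `p`. -/
theorem odd_floor_two_pow_mul_tsum_ite_iff (hp : {n | ¬ p n}.Infinite) (e : ℕ) :
    Odd ⌊(2 : ℝ) ^ (e + 1) * ∑' n : ℕ, (if p n then (2 : ℝ) ^ (-(n + 1 : ℤ)) else 0)⌋ ↔ p e := by
  set f : ℕ → ℝ := fun n => if p n then (2 : ℝ) ^ (-(n + 1 : ℤ)) else 0 with hf
  have hs : Summable f := summable_ite_two_zpow
  obtain ⟨N, hN⟩ := exists_int_eq_two_pow_mul_sum_ite (p := p) e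
  have htail : ∀ i, (2 : ℝ) ^ (e + 1) * f (i + (e + 1)) =
      if p (i + (e + 1)) then 1 / 2 / 2 ^ i else 0 := by
    intro i
    simp only [hf]
    split_ifs
    · have h : -(((i + (e + 1) : ℕ) : ℤ) + 1) = -((i + (e + 1) + 1 : ℕ) : ℤ) := by push_cast; ring
      rw [h, zpow_neg, zpow_natCast]
      field_simp
      ring
    · simp
  have hst : Summable fun i => (2 : ℝ) ^ (e + 1) * f (i + (e + 1)) :=
    ((summable_nat_add_iff (e + 1)).2 hs).mul_left _
  have hle : ∀ i, (2 : ℝ) ^ (e + 1) * f (i + (e + 1)) ≤ 1 / 2 / 2 ^ i := by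
    intro i
    rw [htail]
    split_ifs
    · exact le_rfl
    · positivity
  have h0 : 0 ≤ ∑' i, (2 : ℝ) ^ (e + 1) * f (i + (e + 1)) := by
    refine tsum_nonneg fun i => ?_
    rw [htail]
    split_ifs <;> positivity
  have h1 : ∑' i, (2 : ℝ) ^ (e + 1) * f (i + (e + 1)) < 1 := by
    obtain ⟨m, hm, hem⟩ := hp.exists_gt e
    obtain ⟨k, rfl⟩ := Nat.exists_eq_add_of_le' (Nat.succ_le_of_lt hem)
    rw [← tsum_geometric_two' 1]
    refine Summable.tsum_lt_tsum (i := k) hle ?_ hst (summable_geometric_two' 1)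
    rw [htail, if_neg hm]
    positivity
  have hfloor : ⌊(2 : ℝ) ^ (e + 1) * ∑' n, f n⌋ = 2 * N + if p e then 1 else 0 := by
    have hhead : (2 : ℝ) ^ (e + 1) * ∑ i ∈ Finset.range (e + 1), f i =
        2 * N + if p e then 1 else 0 := by
      rw [Finset.sum_range_succ, mul_add, pow_succ', mul_assoc, hN]
      congr 1
      simp only [hf]
      split_ifs
      · rw [← pow_succ', zpow_neg]
        norm_cast
        exact mul_inv_cancel₀ (by positivity)
      · simp
    rw [← hs.sum_add_tsum_nat_add (e + 1), mul_add, hhead, ← tsum_mul_left, Int.floor_eq_iff]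
    push_cast
    constructor <;> linarith
  rw [hfloor]
  split_ifs with h
  · simp [h]
  · simp [h]

end BinaryExpansion

theorem haltingProbability_digit_iff_halts (e : ℕ) :
    ((Denumerable.ofNat Nat.Partrec.Code e).eval 0).Dom ↔
      Odd ⌊(2 : ℝ) ^ (e + 1) * haltingProbability⌋ := by
  classical
  rw [haltingProbability]
  exact (odd_floor_two_pow_mul_tsum_ite_iff
    (Nat.Partrec.Code.infinite_setOf_not_dom_eval 0) e).symm
end

section
/- The halting probability α is an uncomputable real: the function ℕ → Bool sending e to the (e+1)-st binary digit of α, i.e. e ↦ decide (⌊2^{e+1} · α⌋ % 2 = 1), is not computable. -/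
open Classical in
/-- The sum of `2^{-(e+1)}` over all `e` satisfying `p`. -/
noncomputable def binarySum (p : ℕ → Prop) : ℝ :=
  ∑' e : ℕ, if p e then (2 : ℝ) ^ (-(e + 1 : ℤ)) else 0

theorem hasSum_two_zpow_neg_succ : HasSum (fun e : ℕ => (2 : ℝ) ^ (-(e + 1 : ℤ))) 1 := by
  convert hasSum_geometric_two' (1 : ℝ) using 2 with e
  rw [neg_add, zpow_add₀ two_ne_zero, zpow_neg, zpow_natCast, zpow_neg_one]
  ring

open Classical in
theorem summable_binarySum (p : ℕ → Prop) :
    Summable fun e : ℕ => if p e then (2 : ℝ) ^ (-(e + 1 : ℤ)) else 0 :=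
  hasSum_two_zpow_neg_succ.summable.of_nonneg_of_le
    (fun e => by split_ifs <;> positivity)
    (fun e => by split_ifs; exacts [le_rfl, by positivity])

theorem binarySum_nonneg (p : ℕ → Prop) : 0 ≤ binarySum p :=
  tsum_nonneg fun e => by split_ifs <;> positivity

theorem binarySum_lt_one {p : ℕ → Prop} {m : ℕ} (hm : ¬ p m) : binarySum p < 1 := by
  rw [← hasSum_two_zpow_neg_succ.tsum_eq]
  refine (summable_binarySum p).tsum_lt_tsum (i := m) (fun e => ?_) ?_
    hasSum_two_zpow_neg_succ.summable
  · dsimp only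
    split_ifs
    exacts [le_rfl, by positivity]
  · rw [if_neg hm]
    positivity

open Classical in
theorem two_mul_binarySum (p : ℕ → Prop) :
    2 * binarySum p = ((if p 0 then 1 else 0 : ℤ) : ℝ) + binarySum fun e => p (e + 1) := by
  unfold binarySum
  rw [(summable_binarySum p).tsum_eq_zero_add, mul_add, ← tsum_mul_left]
  congr 1
  · split_ifs <;> norm_num
  · refine tsum_congr fun e => ?_
    split_ifs
    · rw [← zpow_one_add₀ two_ne_zero]
      congr 1
    · simp

theorem exists_lt_not_succ {p : ℕ → Prop} (hp : ∀ n, ∃ m, n < m ∧ ¬ p m) (n : ℕ) :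
    ∃ m, n < m ∧ ¬ p (m + 1) := by
  obtain ⟨m, hnm, hm⟩ := hp (n + 1)
  obtain ⟨k, rfl⟩ := Nat.exists_eq_add_of_lt (Nat.zero_lt_of_lt hnm)
  exact ⟨k, by omega, by simpa using hm⟩

/-- If `p` fails infinitely often, the binary digits of `binarySum p` are the truth values of
`p`. -/
theorem floor_two_pow_mul_binarySum_mod_two {p : ℕ → Prop} (hp : ∀ n, ∃ m, n < m ∧ ¬ p m) (e : ℕ) :
    ⌊(2 : ℝ) ^ (e + 1) * binarySum p⌋ % 2 = 1 ↔ p e := by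
  classical
  induction e generalizing p with
  | zero =>
    obtain ⟨m, -, hm⟩ := exists_lt_not_succ hp 0
    have hfloor : ⌊binarySum fun e => p (e + 1)⌋ = 0 :=
      Int.floor_eq_zero_iff.2 ⟨binarySum_nonneg _, binarySum_lt_one (m := m) hm⟩
    rw [zero_add, pow_one, two_mul_binarySum, Int.floor_intCast_add, hfloor]
    split_ifs with h <;> simp [h]
  | succ e ih =>
    have hshift : (2 : ℝ) ^ (e + 1 + 1) * binarySum p =
        ((2 * (2 ^ e * if p 0 then 1 else 0) : ℤ) : ℝ) +
          2 ^ (e + 1) * binarySum fun e => p (e + 1) := by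
      rw [pow_succ, mul_assoc, two_mul_binarySum, mul_add]
      push_cast
      ring
    rw [hshift, Int.floor_intCast_add, Int.mul_add_emod_self_left]
    exact ih (exists_lt_not_succ hp)

/-- There are arbitrarily large indices of codes that do not halt on a given input. -/
theorem exists_lt_not_dom_eval (a n : ℕ) :
    ∃ m, n < m ∧ ¬ ((Denumerable.ofNat Nat.Partrec.Code m).eval a).Dom := by
  obtain ⟨c, hc⟩ := Nat.Partrec.Code.exists_code.1 Nat.Partrec.none
  have hinj : Function.Injective fun k => Encodable.encode (c.comp (Nat.Partrec.Code.const k)) :=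
    fun k l h => Nat.Partrec.Code.const_inj
      (Nat.Partrec.Code.comp.inj (Encodable.encode_injective h)).2
  obtain ⟨_, ⟨k, rfl⟩, hk⟩ := (Set.infinite_range_of_injective hinj).exists_gt n
  refine ⟨_, hk, ?_⟩
  simp [Nat.Partrec.Code.eval, hc]

theorem haltingProbability_digits_not_computable :
    ¬ Computable (fun e : ℕ =>
      decide (⌊(2 : ℝ) ^ (e + 1) * haltingProbability⌋ % 2 = 1)) := by
  intro h
  refine ComputablePred.halting_problem 0 ?_
  have hdigit (c : Nat.Partrec.Code) :
      ⌊(2 : ℝ) ^ (Encodable.encode c + 1) * haltingProbability⌋ % 2 = 1 ↔ (c.eval 0).Dom := by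
    simpa [binarySum, haltingProbability] using
      floor_two_pow_mul_binarySum_mod_two (exists_lt_not_dom_eval 0) (Encodable.encode c)
  have hcode : ComputablePred fun c : Nat.Partrec.Code =>
      ⌊(2 : ℝ) ^ (Encodable.encode c + 1) * haltingProbability⌋ % 2 = 1 :=
    ⟨inferInstance, h.comp Computable.encode⟩
  exact hcode.of_eq hdigit
end

section
/- Halting times cannot be computably bounded: there is no computable function F : ℕ → ℕ such that for every e, if code e halts on input 0 then it halts within F(e) steps, i.e. (Nat.Partrec.Code.evaln (F e) (Nat.Partrec.Code.ofNat e) 0).isSome. -/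
theorem no_computable_halting_time_bound :
    ¬ ∃ F : ℕ → ℕ, Computable F ∧
      ∀ e : ℕ, ((Denumerable.ofNat Nat.Partrec.Code e).eval 0).Dom →
        (Nat.Partrec.Code.evaln (F e) (Denumerable.ofNat Nat.Partrec.Code e) 0).isSome := by
  rintro ⟨F, hF, hbound⟩
  refine ComputablePred.halting_problem 0 (ComputablePred.computable_iff.2
    ⟨fun c => (Nat.Partrec.Code.evaln (F (Encodable.encode c)) c 0).isSome, ?_, ?_⟩)
  · exact Primrec.option_isSome.to_comp.comp (Nat.Partrec.Code.primrec_evaln.to_comp.comp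
      (((hF.comp Computable.encode).pair Computable.id).pair (Computable.const 0)))
  · funext c
    refine propext ⟨fun h => ?_, fun h => ?_⟩
    · simpa using hbound (Encodable.encode c) (by simpa using h)
    · obtain ⟨x, hx⟩ := Option.isSome_iff_exists.1 h
      exact Part.dom_iff_mem.2 ⟨x, Nat.Partrec.Code.evaln_sound hx⟩
end
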